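/- Let N = {1,…,2n} carry a coloring with exactly n black and n white nodes, let T be the set of nodes that are either odd and white or even and black, and let S ⊆ N be balanced. Let ρ₀ be a black-white pairing with ρ₀(S) = S whose restrictions to S and to N \ S have no crossings. Let π be an odd-even pairing with π(S △ T) = S △ T, and let ρ be a black-white pairing with ρ(S) = S. Then (−1)^{(number of crossings of ρ₀)} = (−1)^n · (−1)^{(number of components of π ∪ ρ)} · sign_OE(π) · sign_BW(ρ). -/

import Mathlib

namespace DD

/-- The node set `{1, …, 2n}`. -/
def nodes (n : ℕ) : Finset ℕ := Finset.Icc 1 (2 * n)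

/-- `ρ` is a pairing of `{1,…,2n}`: a fixed-point-free involution of the node set. -/
structure IsPairing (n : ℕ) (ρ : ℕ → ℕ) : Prop where
  maps : ∀ i ∈ nodes n, ρ i ∈ nodes n
  invol : ∀ i ∈ nodes n, ρ (ρ i) = i
  nofix : ∀ i ∈ nodes n, ρ i ≠ i

/-- Number of crossings of `ρ` among pairs of `ρ` contained in `A`:
a crossing is a pair of pairs `(a,c)`, `(b,d)` of `ρ` with `a < b < c < d`. -/
def numCrossingsOn (A : Finset ℕ) (ρ : ℕ → ℕ) : ℕ :=
  ((A ×ˢ A).filter (fun p => p.1 < p.2 ∧ p.2 < ρ p.1 ∧ ρ p.1 < ρ p.2)).card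

/-- Number of crossings of a pairing of `{1,…,2n}`. -/
def numCrossings (n : ℕ) (ρ : ℕ → ℕ) : ℕ := numCrossingsOn (nodes n) ρ

/-- A pairing is planar if it has no crossings. -/
def IsPlanar (n : ℕ) (ρ : ℕ → ℕ) : Prop := numCrossings n ρ = 0

/-- A coloring `c : ℕ → Bool` of the nodes: `true` = black, `false` = white.
A black-white pairing pairs each black node with a white node. -/
def IsBW (n : ℕ) (c : ℕ → Bool) (ρ : ℕ → ℕ) : Prop :=
  ∀ i ∈ nodes n, c (ρ i) = !(c i)

/-- An odd-even pairing pairs each odd node with an even node. -/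
def IsOE (n : ℕ) (ρ : ℕ → ℕ) : Prop :=
  ∀ i ∈ nodes n, ρ i % 2 ≠ i % 2

/-- The coloring has exactly `n` black (hence exactly `n` white) nodes. -/
def BalancedColoring (n : ℕ) (c : ℕ → Bool) : Prop :=
  ((nodes n).filter (fun i => c i = true)).card = n

/-- The black nodes. -/
def blacks (n : ℕ) (c : ℕ → Bool) : Finset ℕ := (nodes n).filter (fun i => c i = true)

/-- The white nodes. -/
def whites (n : ℕ) (c : ℕ → Bool) : Finset ℕ := (nodes n).filter (fun i => c i = false)

/-- `sign_BW(ρ)`: the sign of the permutation sending `i` to the rank of `w_i = ρ(b_i)`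
among the white nodes, computed as `(-1)` to the number of inversions, i.e. the number of
pairs of black nodes `b < b'` with `ρ b > ρ b'`. -/
def signBW (n : ℕ) (c : ℕ → Bool) (ρ : ℕ → ℕ) : ℤ :=
  (-1 : ℤ) ^ (((nodes n ×ˢ nodes n).filter
    (fun p => c p.1 = true ∧ c p.2 = true ∧ p.1 < p.2 ∧ ρ p.2 < ρ p.1)).card)

/-- `sign_OE(π)`: the sign of the permutation sending `i` to `π(2i−1)/2`, computed as
`(-1)` to the number of pairs of odd nodes `a < b` with `π a > π b`. -/
def signOE (n : ℕ) (π : ℕ → ℕ) : ℤ :=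
  (-1 : ℤ) ^ (((nodes n ×ˢ nodes n).filter
    (fun p => p.1 % 2 = 1 ∧ p.2 % 2 = 1 ∧ p.1 < p.2 ∧ π p.2 < π p.1)).card)

/-- `a_{b,w}`: the number of indices `i` with `min b w ≤ i < max b w` such that nodes `i`
and `i+1` have the same color. -/
def aCount (c : ℕ → Bool) (b w : ℕ) : ℕ :=
  ((Finset.Ico (min b w) (max b w)).filter (fun i => c i = c (i + 1))).card

/-- `sign(b,w) = (−1)^{(|b−w| + a_{b,w} − 1)/2}` for a black node `b` and white node `w`. -/
def pairSign (c : ℕ → Bool) (b w : ℕ) : ℤ :=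
  (-1 : ℤ) ^ ((max b w - min b w + aCount c b w - 1) / 2)

/-- Cyclic successor of node `m` in `{1,…,2n}`. -/
def nextNode (n m : ℕ) : ℕ := if m = 2 * n then 1 else m + 1

/-- Couples of consecutive nodes of the same color, cyclically: indices `m ∈ {1,…,2n}`
with nodes `m` and `m+1` (cyclically) of the same color. -/
def couples (n : ℕ) (c : ℕ → Bool) : Finset ℕ :=
  (nodes n).filter (fun m => c m = c (nextNode n m))

/-- The value `φ(m)` for a couple `m`: writing `r` for the rank of `m` among couples of its
own color, `φ(m) = 2r` if `m` has the same color as node `1`, and `φ(m) = 2r − 1` otherwise. -/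
def phiCouple (n : ℕ) (c : ℕ → Bool) (m : ℕ) : ℕ :=
  if c m = c 1 then 2 * ((couples n c).filter (fun m' => c m' = c m ∧ m' ≤ m)).card
  else 2 * ((couples n c).filter (fun m' => c m' = c m ∧ m' ≤ m)).card - 1

/-- `sign_cons(N)`: the sign of the one-line permutation `(φ(n₁),…,φ(n_{2k}))`, computed
as `(-1)` to its number of inversions. -/
def signCons (n : ℕ) (c : ℕ → Bool) : ℤ :=
  (-1 : ℤ) ^ (((couples n c ×ˢ couples n c).filter
    (fun p => p.1 < p.2 ∧ phiCouple n c p.2 < phiCouple n c p.1)).card)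

/-- The set `T` of nodes that are odd and white, or even and black. -/
def Tset (n : ℕ) (c : ℕ → Bool) : Finset ℕ :=
  (nodes n).filter (fun i => (i % 2 = 1 ∧ c i = false) ∨ (i % 2 = 0 ∧ c i = true))

/-- A subset is balanced if it contains equally many black and white nodes. -/
def BalancedSubset (c : ℕ → Bool) (S : Finset ℕ) : Prop :=
  (S.filter (fun i => c i = true)).card = (S.filter (fun i => c i = false)).card

/-- `ρ` does not connect `S` to its complement: `ρ(S) = S`. -/
def Invariant (S : Finset ℕ) (ρ : ℕ → ℕ) : Prop := ∀ i ∈ S, ρ i ∈ S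

/-- Reachability under the subgroup generated by the involutions `π` and `ρ`. -/
def compRel (n : ℕ) (π ρ : ℕ → ℕ) (a b : ℕ) : Prop :=
  Relation.ReflTransGen (fun u v => u ∈ nodes n ∧ (v = π u ∨ v = ρ u)) a b

open scoped Classical in
/-- The number of components (orbits) of `π ∪ ρ` on the node set. -/
noncomputable def numComponents (n : ℕ) (π ρ : ℕ → ℕ) : ℕ :=
  ((nodes n).image (fun a => (nodes n).filter (fun b => compRel n π ρ a b))).card



/-- Indicator in `ZMod 2`. -/
def ind (p : Prop) [Decidable p] : ZMod 2 := if p then 1 else 0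

/-- Inversions of `ρ` on the nodes selected by `X`. -/
def invX (n : ℕ) (X : ℕ → Bool) (ρ : ℕ → ℕ) : ℕ :=
  ((nodes n ×ˢ nodes n).filter
    (fun p => X p.1 = true ∧ X p.2 = true ∧ p.1 < p.2 ∧ ρ p.2 < ρ p.1)).card

/-- Crossing indicator. -/
def crf (ρ : ℕ → ℕ) (a b : ℕ) : ZMod 2 := ind (a < b ∧ b < ρ a ∧ ρ a < ρ b)

lemma z2 (a : ZMod 2) : a + a = 0 := CharTwo.add_self_eq_zero a

lemma card_cast (A : Finset ℕ) (P : ℕ × ℕ → Prop) [DecidablePred P] :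
    ((((A ×ˢ A).filter P).card : ℕ) : ZMod 2) = ∑ a ∈ A, ∑ b ∈ A, ind (P (a, b)) := by
  rw [Finset.card_filter, Finset.sum_product]
  push_cast
  rfl

lemma cross_cast (A : Finset ℕ) (ρ : ℕ → ℕ) :
    ((numCrossingsOn A ρ : ℕ) : ZMod 2) = ∑ a ∈ A, ∑ b ∈ A, crf ρ a b := by
  unfold numCrossingsOn
  rw [card_cast]
  rfl

/-- Sums over the nodes of functions that cancel along the pairing. -/
lemma sum_pair {n : ℕ} {ρ : ℕ → ℕ} (A : Finset ℕ) (hA : A ⊆ nodes n) (hρ : IsPairing n ρ)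
    (hinv : Invariant A ρ) (D : ℕ → ZMod 2) (hD : ∀ a ∈ A, D a + D (ρ a) = 0) :
    ∑ a ∈ A, D a = 0 := by
  refine Finset.sum_involution (fun a _ => ρ a) (fun a ha => hD a ha) ?_ ?_ ?_
  · intro a ha _
    exact hρ.nofix a (hA ha)
  · intro a ha
    exact hinv a ha
  · intro a ha
    exact hρ.invol a (hA ha)

lemma add_eq_zero_two {a b : ZMod 2} : a + b = 0 → a = b := by
  revert a b; decide

lemma sum_split {n : ℕ} {ρ : ℕ → ℕ} (hρ : IsPairing n ρ) (X : ℕ → Bool)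
    (hX : ∀ i ∈ nodes n, X (ρ i) = !(X i)) (g : ℕ → ZMod 2) :
    ∑ a ∈ nodes n, g a = ∑ a ∈ nodes n, ind (X a = true) * (g a + g (ρ a)) := by
  apply add_eq_zero_two
  rw [← Finset.sum_add_distrib]
  refine sum_pair (nodes n) (le_refl _) hρ hρ.maps _ ?_
  intro a ha
  rw [hX a ha, hρ.invol a ha]
  cases X a <;> simp [ind] <;> generalize g a = u <;> generalize g (ρ a) = v <;> revert u v <;> decide

lemma sum_tri (A : Finset ℕ) (g : ℕ → ℕ → ZMod 2) :
    ∑ a ∈ A, ∑ b ∈ A, g a b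
      = ∑ a ∈ A, ∑ b ∈ A, ind (a < b) * (g a b + g b a) + ∑ a ∈ A, g a a := by
  have h1 : ∑ a ∈ A, g a a = ∑ a ∈ A, ∑ b ∈ A, ind (a = b) * g a b := by
    refine Finset.sum_congr rfl fun a ha => ?_
    simp [ind, ha]
  have h2 : ∑ a ∈ A, ∑ b ∈ A, ind (a < b) * g b a = ∑ a ∈ A, ∑ b ∈ A, ind (b < a) * g a b :=
    Finset.sum_comm
  simp only [mul_add, Finset.sum_add_distrib]
  rw [h1, h2]
  simp only [← Finset.sum_add_distrib, ← add_mul]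
  refine Finset.sum_congr rfl fun a ha => Finset.sum_congr rfl fun b hb => ?_
  rcases lt_trichotomy a b with h | h | h
  · simp [ind, h, h.ne, h.not_gt]
  · simp [ind, h]
  · simp [ind, h, h.ne', h.not_gt]

lemma sum_lt_nodes {n a : ℕ} (ha : a ∈ nodes n) :
    ∑ b ∈ nodes n, ind (b < a) = (a : ZMod 2) + 1 := by
  unfold ind
  rw [← Finset.sum_filter, Finset.sum_const]
  have : (nodes n).filter (fun b => b < a) = Finset.Ico 1 a := by
    ext b
    simp only [nodes, Finset.mem_filter, Finset.mem_Icc, Finset.mem_Ico] at *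
    omega
  rw [this]
  simp only [nodes, Finset.mem_Icc] at ha
  obtain ⟨k, rfl⟩ : ∃ k, a = k + 1 := ⟨a - 1, by omega⟩
  simp
  rw [add_assoc, z2, add_zero]

lemma key_point {a b a' b' : ℕ} (h : a < b) (h1 : a' ≠ a) (h2 : a' ≠ b) (h3 : b' ≠ a)
    (h4 : b' ≠ b) (h5 : a' ≠ b') :
    (ind (a < b ∧ b < a' ∧ a' < b') + ind (a < b' ∧ b' < a' ∧ a' < b)
      + (ind (a' < b ∧ b < a ∧ a < b') + ind (a' < b' ∧ b' < a ∧ a < b)))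
    + (ind (b < a ∧ a < b' ∧ b' < a') + ind (b < a' ∧ a' < b' ∧ b' < a)
      + (ind (b' < a ∧ a < b ∧ b < a') + ind (b' < a' ∧ a' < b ∧ b < a)))
    = ind (b' < a') + ind (b' < a) + (1 + ind (a' < b)) := by
  rcases lt_or_gt_of_ne h1 with h1 | h1 <;> rcases lt_or_gt_of_ne h2 with h2 | h2 <;>
  rcases lt_or_gt_of_ne h3 with h3 | h3 <;> rcases lt_or_gt_of_ne h4 with h4 | h4 <;>
  rcases lt_or_gt_of_ne h5 with h5 | h5 <;>
  first
  | (exfalso; omega)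
  | (simp [ind, h, h1, h2, h3, h4, h5, h.not_gt, h1.not_gt, h2.not_gt, h3.not_gt, h4.not_gt,
      h5.not_gt]; try decide)

lemma cross_formula {n : ℕ} {ρ : ℕ → ℕ} (hρ : IsPairing n ρ) (X : ℕ → Bool)
    (hX : ∀ i ∈ nodes n, X (ρ i) = !(X i)) :
    ((numCrossings n ρ : ℕ) : ZMod 2) + ((invX n X ρ : ℕ) : ZMod 2)
      = ∑ a ∈ nodes n, ind (X a = true) * (ind (ρ a < a) + ((a : ZMod 2) + 1)) := by
  set N := nodes n with hN
  have inj : ∀ a ∈ N, ∀ b ∈ N, ρ a = ρ b → a = b := by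
    intro a ha b hb h
    rw [← hρ.invol a ha, ← hρ.invol b hb, h]
  -- the crossing number as a sum over `X × X`
  have e1 : ((numCrossings n ρ : ℕ) : ZMod 2) = ∑ a ∈ N, ∑ b ∈ N,
      ind (X a = true) * ind (X b = true) *
        (crf ρ a b + crf ρ a (ρ b) + (crf ρ (ρ a) b + crf ρ (ρ a) (ρ b))) := by
    unfold numCrossings
    rw [cross_cast]
    rw [sum_split hρ X hX]
    refine Finset.sum_congr rfl fun a ha => ?_
    rw [sum_split hρ X hX, sum_split hρ X hX (fun b => crf ρ (ρ a) b),
      ← Finset.sum_add_distrib, Finset.mul_sum]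
    refine Finset.sum_congr rfl fun b hb => ?_
    ring
  have e2 : ((invX n X ρ : ℕ) : ZMod 2) = ∑ a ∈ N, ∑ b ∈ N,
      ind (a < b) * (ind (X a = true) * ind (X b = true) * ind (ρ b < ρ a)) := by
    unfold invX
    rw [card_cast]
    refine Finset.sum_congr rfl fun a ha => Finset.sum_congr rfl fun b hb => ?_
    simp only [ind]
    split_ifs <;> simp_all
  have e3 : ((numCrossings n ρ : ℕ) : ZMod 2) + ((invX n X ρ : ℕ) : ZMod 2)
      = ∑ a ∈ N, ∑ b ∈ N, ind (a < b) *
        (ind (X a = true) * ind (X b = true) * ind (ρ b < a)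
          + ind (X b = true) * ind (X a = true) * ind (ρ a < b))
        + ∑ a ∈ N, ∑ b ∈ N, ind (a < b) * (ind (X a = true) * ind (X b = true)) := by
    rw [e1, sum_tri, e2]
    have hd : ∑ a ∈ N, ind (X a = true) * ind (X a = true) *
        (crf ρ a a + crf ρ a (ρ a) + (crf ρ (ρ a) a + crf ρ (ρ a) (ρ a))) = 0 := by
      refine Finset.sum_eq_zero fun a ha => ?_
      have hz : crf ρ a a + crf ρ a (ρ a) + (crf ρ (ρ a) a + crf ρ (ρ a) (ρ a)) = 0 := by
        simp only [crf, ind, hρ.invol a ha]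
        rw [if_neg (by omega), if_neg (by omega), if_neg (by omega), if_neg (by omega)]
        simp
      rw [hz, mul_zero]
    rw [hd, add_zero]
    simp only [← Finset.sum_add_distrib]
    refine Finset.sum_congr rfl fun a ha => Finset.sum_congr rfl fun b hb => ?_
    by_cases hab : a < b
    swap
    · simp [ind, hab]
    by_cases hXa : X a = true
    swap
    · simp [ind, hXa]
    by_cases hXb : X b = true
    swap
    · simp [ind, hXb]
    have h2 : ρ a ≠ b := by
      intro h
      have := hX a ha
      rw [h, hXa, hXb] at this
      simp at this
    have h3 : ρ b ≠ a := by
      intro h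
      have := hX b hb
      rw [h, hXa, hXb] at this
      simp at this
    have h5 : ρ a ≠ ρ b := fun h => hab.ne (inj a ha b hb h)
    have key := key_point hab (hρ.nofix a ha) h2 h3 (hρ.nofix b hb) h5
    have i1 : ind (X a = true) = 1 := by simp [ind, hXa]
    have i2 : ind (X b = true) = 1 := by simp [ind, hXb]
    have i3 : ind (a < b) = 1 := by simp [ind, hab]
    rw [i1, i2, i3]
    simp only [crf, hρ.invol a ha, hρ.invol b hb, one_mul, mul_one]
    rw [key]
    linear_combination z2 (ind (ρ b < ρ a))
  have e4 := sum_tri N (fun a b => ind (X a = true) * ind (X b = true) * ind (ρ b < a))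
  have e5 : ∑ a ∈ N, ∑ b ∈ N, ind (X a = true) * ind (X b = true) * ind (ρ b < a)
      = ∑ a ∈ N, ∑ b ∈ N, ind (X a = true) * (1 + ind (X b = true)) * ind (b < a) := by
    refine Finset.sum_congr rfl fun a ha => ?_
    apply add_eq_zero_two
    rw [← Finset.sum_add_distrib]
    refine sum_pair N (le_refl _) hρ hρ.maps _ ?_
    intro b hb
    rw [hX b hb, hρ.invol b hb]
    cases X b <;> simp [ind] <;> split_ifs <;> first | decide | simp
  have e6 : ∑ a ∈ N, ∑ b ∈ N, ind (a < b) * (ind (X a = true) * ind (X b = true))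
      = ∑ a ∈ N, ∑ b ∈ N, ind (b < a) * (ind (X b = true) * ind (X a = true)) :=
    Finset.sum_comm
  have e7 : ∑ a ∈ N, ∑ b ∈ N, ind (X a = true) * (1 + ind (X b = true)) * ind (b < a)
      = ∑ a ∈ N, ind (X a = true) * ((a : ZMod 2) + 1) +
       ∑ a ∈ N, ∑ b ∈ N, ind (a < b) * (ind (X a = true) * ind (X b = true)) := by
    rw [e6, ← Finset.sum_add_distrib]
    refine Finset.sum_congr rfl fun a ha => ?_
    rw [← sum_lt_nodes ha, Finset.mul_sum, ← Finset.sum_add_distrib]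
    refine Finset.sum_congr rfl fun b hb => ?_
    ring
  have e8 : ∑ a ∈ N, ind (X a = true) * ind (X a = true) * ind (ρ a < a)
      = ∑ a ∈ N, ind (X a = true) * ind (ρ a < a) := by
    refine Finset.sum_congr rfl fun a ha => ?_
    cases X a <;> simp [ind]
  simp only [mul_add, Finset.sum_add_distrib] at *
  generalize ∑ a ∈ N, ∑ b ∈ N, ind (a < b) * (ind (X a = true) * ind (X b = true)) = q at *
  rw [e8] at e4
  generalize ∑ a ∈ N, ind (X a = true) * ind (ρ a < a) = r at *
  linear_combination e3 - e4 + e5 + e7 + z2 q - z2 r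

lemma desc_formula {n : ℕ} {ρ : ℕ → ℕ} (hρ : IsPairing n ρ) (X Y : ℕ → Bool)
    (hX : ∀ i ∈ nodes n, X (ρ i) = !(X i)) (hY : ∀ i ∈ nodes n, Y (ρ i) = !(Y i)) :
    ∑ a ∈ nodes n, ind (X a = true) * ind (ρ a < a)
      + ∑ a ∈ nodes n, ind (Y a = true) * ind (ρ a < a)
      = ∑ a ∈ nodes n, ind (X a = true) * (1 + ind (Y a = true)) := by
  apply add_eq_zero_two
  simp only [← Finset.sum_add_distrib]
  refine sum_pair (nodes n) (le_refl _) hρ hρ.maps _ ?_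
  intro a ha
  rw [hX a ha, hY a ha, hρ.invol a ha]
  rcases lt_or_gt_of_ne (hρ.nofix a ha) with h | h <;>
  cases X a <;> cases Y a <;> simp [ind, h, h.not_gt] <;> decide

lemma inv_compare {n : ℕ} {ρ : ℕ → ℕ} (hρ : IsPairing n ρ) (X Y : ℕ → Bool)
    (hX : ∀ i ∈ nodes n, X (ρ i) = !(X i)) (hY : ∀ i ∈ nodes n, Y (ρ i) = !(Y i)) :
    ((invX n X ρ : ℕ) : ZMod 2) + ((invX n Y ρ : ℕ) : ZMod 2)
      = ∑ a ∈ nodes n, ((ind (X a = true) + ind (Y a = true)) * ((a : ZMod 2) + 1)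
        + ind (X a = true) * (1 + ind (Y a = true))) := by
  have h1 := cross_formula hρ X hX
  have h2 := cross_formula hρ Y hY
  have h3 := desc_formula hρ X Y hX hY
  simp only [mul_add, add_mul, Finset.sum_add_distrib] at *
  linear_combination h1 + h2 + h3 - z2 ((numCrossings n ρ : ℕ) : ZMod 2)

/-- Crossing parity of a pairing planar on `S` and on the complement. -/
lemma cross_planar {n : ℕ} {ρ : ℕ → ℕ} (hρ : IsPairing n ρ) (c : ℕ → Bool)
    (hc : ∀ i ∈ nodes n, c (ρ i) = !(c i)) (S : Finset ℕ) (hS : S ⊆ nodes n)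
    (hinv : Invariant S ρ) (h1 : numCrossingsOn S ρ = 0)
    (h2 : numCrossingsOn (nodes n \ S) ρ = 0) :
    ((numCrossings n ρ : ℕ) : ZMod 2) = ∑ a ∈ S, ((a : ZMod 2) + ind (c a = true)) := by
  have inj : ∀ a ∈ nodes n, ∀ b ∈ nodes n, ρ a = ρ b → a = b := by
    intro a ha b hb h
    rw [← hρ.invol a ha, ← hρ.invol b hb, h]
  have z1 := cross_cast S ρ
  have z2' := cross_cast (nodes n \ S) ρ
  rw [h1] at z1
  rw [h2] at z2'
  have e1 : ((numCrossings n ρ : ℕ) : ZMod 2)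
      = ∑ a ∈ S, ∑ b ∈ nodes n, (crf ρ a b + crf ρ b a) := by
    unfold numCrossings
    rw [cross_cast]
    have hsp : ∀ g : ℕ → ZMod 2,
        ∑ a ∈ nodes n, g a = ∑ a ∈ nodes n \ S, g a + ∑ a ∈ S, g a :=
      fun g => (Finset.sum_sdiff hS).symm
    simp only [hsp, Finset.sum_add_distrib]
    rw [Finset.sum_comm (s := S) (t := nodes n \ S) (f := fun a b => crf ρ b a),
      Finset.sum_comm (s := S) (t := S) (f := fun a b => crf ρ b a), ← z1, ← z2']
    simp
    ring
  have e2 : ∀ a ∈ nodes n, ∑ b ∈ nodes n, (crf ρ a b + crf ρ b a)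
      = ind (a < ρ a) * ((a : ZMod 2) + (ρ a : ℕ) + 1) := by
    intro a ha
    by_cases hlt : a < ρ a
    · have : ind (a < ρ a) * ((a : ZMod 2) + (ρ a : ℕ) + 1)
          = ∑ b ∈ nodes n, (ind (b < a) + ind (b < ρ a) + ind (b = a)) := by
        rw [Finset.sum_add_distrib, Finset.sum_add_distrib, sum_lt_nodes ha,
          sum_lt_nodes (hρ.maps a ha)]
        simp [ind, hlt, ha]
        linear_combination - z2 1
      rw [this]
      apply add_eq_zero_two
      rw [← Finset.sum_add_distrib]
      refine sum_pair (nodes n) (le_refl _) hρ hρ.maps _ ?_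
      intro b hb
      simp only [crf]
      rw [hρ.invol b hb]
      by_cases hba : b = a
      · subst hba
        simp [ind, hlt, hlt.not_gt, hlt.ne', hlt.ne]
        try decide
      by_cases hba' : b = ρ a
      · subst hba'
        rw [hρ.invol a ha]
        simp [ind, hlt, hlt.not_gt, hlt.ne', hlt.ne]
        try decide
      have h3 : ρ b ≠ a := fun h => hba' (by rw [← h, hρ.invol b hb])
      have h4 := hρ.nofix b hb
      have h5 : ρ b ≠ ρ a := fun h => hba (inj b hb a ha h)
      generalize ρ a = a' at *
      generalize ρ b = b' at *
      rcases lt_or_gt_of_ne hba with h1 | h1 <;> rcases lt_or_gt_of_ne hba' with h2 | h2 <;>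
      rcases lt_or_gt_of_ne h3 with h3 | h3 <;> rcases lt_or_gt_of_ne h4 with h4 | h4 <;>
      rcases lt_or_gt_of_ne h5 with h5 | h5 <;>
      first
      | (exfalso; omega)
      | (simp [ind, hlt, h1, h2, h3, h4, h5, hlt.not_gt, h1.not_gt, h2.not_gt, h3.not_gt,
          h4.not_gt, h5.not_gt, h1.ne, h1.ne', h3.ne, h3.ne']; try decide)
    · have : ind (a < ρ a) = 0 := by simp [ind, hlt]
      rw [this, zero_mul]
      refine Finset.sum_eq_zero fun b hb => ?_
      simp only [crf, ind]
      rw [if_neg (by omega), if_neg (by omega), add_zero]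
  rw [e1, Finset.sum_congr rfl fun a ha => e2 a (hS ha)]
  apply add_eq_zero_two
  rw [← Finset.sum_add_distrib]
  refine sum_pair S hS hρ hinv _ ?_
  intro a ha
  rw [hρ.invol a (hS ha), hc a (hS ha)]
  generalize ((ρ a : ℕ) : ZMod 2) = u
  generalize (a : ZMod 2) = v
  rcases lt_or_gt_of_ne (hρ.nofix a (hS ha)) with h | h <;>
  cases c a <;> simp [ind, h, h.not_gt] <;> revert u v <;> decide

lemma card_image_eq_of_ker {α β γ : Type*} [DecidableEq β] [DecidableEq γ] (s : Finset α)
    (g : α → β) (h : α → γ) (H : ∀ x ∈ s, ∀ y ∈ s, g x = g y ↔ h x = h y) :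
    (s.image g).card = (s.image h).card := by
  classical
  have h1 : (s.image fun x => (g x, h x)).card = (s.image g).card := by
    have : s.image g = (s.image fun x => (g x, h x)).image Prod.fst := by
      rw [Finset.image_image]; rfl
    rw [this]
    refine (Finset.card_image_of_injOn ?_).symm
    intro p hp q hq hpq
    simp only [Finset.coe_image, Set.mem_image, Finset.mem_coe] at hp hq
    obtain ⟨x, hx, rfl⟩ := hp
    obtain ⟨y, hy, rfl⟩ := hq
    exact Prod.ext hpq ((H x hx y hy).1 hpq)
  have h2 : (s.image fun x => (g x, h x)).card = (s.image h).card := by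
    have : s.image h = (s.image fun x => (g x, h x)).image Prod.snd := by
      rw [Finset.image_image]; rfl
    rw [this]
    refine (Finset.card_image_of_injOn ?_).symm
    intro p hp q hq hpq
    simp only [Finset.coe_image, Set.mem_image, Finset.mem_coe] at hp hq
    obtain ⟨x, hx, rfl⟩ := hp
    obtain ⟨y, hy, rfl⟩ := hq
    exact Prod.ext ((H x hx y hy).2 hpq) hpq
  rw [← h1, h2]

lemma card_orbits {α β : Type*} [Fintype α] [DecidableEq α] [DecidableEq β]
    (f : Equiv.Perm α) (g : α → β) (hg : ∀ x y, g x = g y ↔ f.SameCycle x y) :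
    (Finset.univ.image g).card + f.cycleType.sum
      = Fintype.card α + Multiset.card f.cycleType := by
  have h1 : Finset.univ.image g = f.support.image g ∪ f.supportᶜ.image g := by
    rw [← Finset.image_union]
    simp
  have hfix : ∀ x y, x ∉ f.support → f.SameCycle x y → x = y := by
    intro x y hx hxy
    rw [Equiv.Perm.notMem_support] at hx
    obtain ⟨i, hi⟩ := hxy
    rw [← hi]
    exact (Equiv.Perm.zpow_apply_eq_self_of_apply_eq_self hx i).symm
  have h2 : Disjoint (f.support.image g) (f.supportᶜ.image g) := by
    rw [Finset.disjoint_left]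
    intro z hz hz'
    simp only [Finset.mem_image, Finset.mem_compl] at hz hz'
    obtain ⟨x, hx, rfl⟩ := hz
    obtain ⟨y, hy, hxy⟩ := hz'
    have := hfix y x hy ((hg y x).1 hxy)
    exact hy (this ▸ hx)
  have h3 : (f.supportᶜ.image g).card = f.supportᶜ.card := by
    refine Finset.card_image_of_injOn ?_
    intro x hx y hy hxy
    exact hfix x y (by simpa using hx) ((hg x y).1 hxy)
  have h4 : (f.support.image g).card = (f.support.image f.cycleOf).card := by
    refine card_image_eq_of_ker _ _ _ ?_
    intro x hx y hy
    rw [hg, Equiv.Perm.sameCycle_iff_cycleOf_eq_of_mem_support hx hy]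
  have h5 : f.support.image f.cycleOf = f.cycleFactorsFinset := by
    ext p
    simp only [Finset.mem_image]
    constructor
    · rintro ⟨x, hx, rfl⟩
      exact Equiv.Perm.cycleOf_mem_cycleFactorsFinset_iff.2 hx
    · intro hp
      obtain ⟨x, hx, -⟩ := (Equiv.Perm.mem_cycleFactorsFinset_iff.1 hp).1
      have hx' : x ∈ p.support := Equiv.Perm.mem_support.2 hx
      exact ⟨x, Equiv.Perm.mem_cycleFactorsFinset_support_le hp hx',
        (Equiv.Perm.cycle_is_cycleOf hx' hp).symm⟩
  have h6 : Multiset.card f.cycleType = f.cycleFactorsFinset.card := by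
    rw [Equiv.Perm.cycleType_def, Multiset.card_map]
    rfl
  rw [h1, Finset.card_union_of_disjoint h2, h3, h4, h5, h6, Equiv.Perm.sum_cycleType,
    Finset.card_compl]
  have := Finset.card_le_univ f.support
  omega

/-- The sign of a permutation via its number of inversions. -/
lemma sign_inversions {n : ℕ} (σ : Equiv.Perm (Fin n)) :
    ((Equiv.Perm.sign σ : ℤˣ) : ℤ)
      = (-1) ^ ((Finset.univ : Finset (Fin n × Fin n)).filter
          (fun p => p.1 < p.2 ∧ σ p.2 < σ p.1)).card := by
  rw [σ.sign_eq_prod_prod_Ioi, Finset.card_filter, ← Finset.prod_pow_eq_pow_sum,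
    ← Finset.univ_product_univ, Finset.prod_product]
  push_cast
  refine Finset.prod_congr rfl fun i _ => ?_
  have : Finset.Ioi i = Finset.univ.filter (fun j => i < j) := by ext; simp
  rw [this, Finset.prod_filter]
  refine Finset.prod_congr rfl fun j _ => ?_
  by_cases hij : i < j
  · rcases lt_or_gt_of_ne (σ.injective.ne hij.ne) with h | h <;> simp [hij, h, h.not_gt]
  · simp [hij]

lemma sign_bij {n : ℕ} {ρ : ℕ → ℕ} (X : ℕ → Bool)
    (A C : Finset ℕ) (hA : A = (nodes n).filter (fun i => X i = true))
    (e : Fin n ≃o A) (e' : Fin n ≃o C) (R : A ≃ C) (hR : ∀ x : A, (R x : ℕ) = ρ x) :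
    ((Equiv.Perm.sign ((e.toEquiv.trans R).trans e'.symm.toEquiv) : ℤˣ) : ℤ)
      = (-1) ^ (invX n X ρ) := by
  rw [sign_inversions]
  congr 1
  unfold invX
  refine Finset.card_bij (fun p _ => ((e p.1 : ℕ), (e p.2 : ℕ))) ?_ ?_ ?_
  · intro p hp
    have m1 := (e p.1).2
    have m2 := (e p.2).2
    simp only [hA, Finset.mem_filter] at m1 m2
    simp only [Finset.mem_filter, Finset.mem_univ, true_and, Equiv.trans_apply,
      OrderIso.coe_toEquiv, OrderIso.lt_iff_lt] at hp
    simp only [Finset.mem_filter, Finset.mem_product]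
    refine ⟨⟨m1.1, m2.1⟩, m1.2, m2.2, ?_, ?_⟩
    · exact_mod_cast e.lt_iff_lt.2 hp.1
    · rw [← hR, ← hR]
      exact_mod_cast hp.2
  · intro p _ q _ h
    simp only [Prod.mk.injEq] at h
    exact Prod.ext (e.injective (Subtype.ext h.1)) (e.injective (Subtype.ext h.2))
  · rintro ⟨a, b⟩ h
    simp only [Finset.mem_filter, Finset.mem_product] at h
    have ha : a ∈ A := by simp [hA, h]
    have hb : b ∈ A := by simp [hA, h]
    refine ⟨(e.symm ⟨a, ha⟩, e.symm ⟨b, hb⟩), ?_, by simp⟩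
    simp only [Finset.mem_filter, Finset.mem_univ, true_and, Equiv.trans_apply,
      OrderIso.coe_toEquiv, OrderIso.lt_iff_lt, OrderIso.apply_symm_apply]
    refine ⟨?_, ?_⟩
    · exact_mod_cast h.2.2.2.1
    · rw [← Subtype.coe_lt_coe, hR, hR]
      exact h.2.2.2.2

lemma compRel_nodes {n : ℕ} {π ρ : ℕ → ℕ} (hπ : IsPairing n π) (hρ : IsPairing n ρ) {a b : ℕ}
    (ha : a ∈ nodes n) (h : compRel n π ρ a b) : b ∈ nodes n := by
  induction h with
  | refl => exact ha
  | tail _ h ih =>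
    rcases h.2 with h | h
    · rw [h]; exact hπ.maps _ ih
    · rw [h]; exact hρ.maps _ ih

lemma compRel_symm {n : ℕ} {π ρ : ℕ → ℕ} (hπ : IsPairing n π) (hρ : IsPairing n ρ) {a b : ℕ}
    (ha : a ∈ nodes n) (h : compRel n π ρ a b) : compRel n π ρ b a := by
  induction h with
  | refl => exact Relation.ReflTransGen.refl
  | tail h0 h ih =>
    refine Relation.ReflTransGen.head ?_ ih
    rcases h with ⟨hu, h | h⟩
    · exact ⟨h ▸ hπ.maps _ hu, Or.inl (by rw [h, hπ.invol _ hu])⟩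
    · exact ⟨h ▸ hρ.maps _ hu, Or.inr (by rw [h, hρ.invol _ hu])⟩

/-- The number of components through the inversion signs. -/
lemma comps_formula {n : ℕ} {π ρ : ℕ → ℕ} (hπ : IsPairing n π) (hρ : IsPairing n ρ)
    (X : ℕ → Bool) (hXπ : ∀ i ∈ nodes n, X (π i) = !(X i))
    (hXρ : ∀ i ∈ nodes n, X (ρ i) = !(X i)) :
    (-1 : ℤ) ^ n * (-1 : ℤ) ^ (numComponents n π ρ)
      = (-1) ^ (invX n X π) * (-1) ^ (invX n X ρ) := by
  classical
  set A := (nodes n).filter (fun i => X i = true) with hA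
  set C := (nodes n).filter (fun i => X i = false) with hC
  have mA : ∀ i, i ∈ A ↔ i ∈ nodes n ∧ X i = true := by intro i; simp [hA]
  have mC : ∀ i, i ∈ C ↔ i ∈ nodes n ∧ X i = false := by intro i; simp [hC]
  have mk : ∀ r : ℕ → ℕ, IsPairing n r → (∀ i ∈ nodes n, X (r i) = !(X i)) →
      ∃ R : A ≃ C, (∀ x : A, (R x : ℕ) = r x) ∧ (∀ x : C, (R.symm x : ℕ) = r x) := by
    intro r hr hX
    refine ⟨⟨fun x => ⟨r x, ?_⟩, fun x => ⟨r x, ?_⟩, ?_, ?_⟩, fun x => rfl, fun x => rfl⟩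
    · have := (mA _).1 x.2
      exact (mC _).2 ⟨hr.maps _ this.1, by rw [hX _ this.1, this.2]; rfl⟩
    · have := (mC _).1 x.2
      exact (mA _).2 ⟨hr.maps _ this.1, by rw [hX _ this.1, this.2]; rfl⟩
    · intro x
      exact Subtype.ext (hr.invol _ ((mA _).1 x.2).1)
    · intro x
      exact Subtype.ext (hr.invol _ ((mC _).1 x.2).1)
  obtain ⟨R, hR, hR'⟩ := mk ρ hρ hXρ
  obtain ⟨P, hP, hP'⟩ := mk π hπ hXπ
  have hAC : A.card = C.card := by
    simpa using Fintype.card_congr R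
  have hsum : A.card + C.card = 2 * n := by
    have h1 := Finset.card_filter_add_card_filter_not (s := nodes n) (fun i => X i = true)
    have h2 : (nodes n).card = 2 * n := by simp [nodes]
    simp only [Bool.not_eq_true] at h1
    rw [h2] at h1
    exact h1
  have hAn : A.card = n := by omega
  have hCn : C.card = n := by omega
  let e := A.orderIsoOfFin hAn
  let e' := C.orderIsoOfFin hCn
  have s1 := sign_bij X A C hA e e' R hR
  have s2 := sign_bij X A C hA e e' P hP
  set σR := (e.toEquiv.trans R).trans e'.symm.toEquiv with hσR
  set σP := (e.toEquiv.trans P).trans e'.symm.toEquiv with hσP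
  let τ : Equiv.Perm A := R.trans P.symm
  have hτ : ∀ x : A, (τ x : ℕ) = π (ρ x) := by
    intro x
    change ((P.symm (R x) : A) : ℕ) = _
    rw [hP', hR]
  have s3 : Equiv.Perm.sign τ = Equiv.Perm.sign σP * Equiv.Perm.sign σR := by
    have : τ = (e.toEquiv.symm.trans (σP⁻¹ * σR)).trans e.toEquiv := by
      ext x
      simp [τ, hσR, hσP, Equiv.Perm.inv_def]
    rw [this, Equiv.Perm.sign_symm_trans_trans, Equiv.Perm.sign_mul, Equiv.Perm.sign_inv]
  -- components are the cycles of τ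
  have same : ∀ x y : A, compRel n π ρ x y ↔ τ.SameCycle x y := by
    intro x y
    constructor
    · intro h
      have gen : ∀ b, compRel n π ρ x b →
          ∃ hb : b ∈ nodes n, (∀ h : b ∈ A, τ.SameCycle x ⟨b, h⟩) ∧
            (∀ h : b ∈ C, τ.SameCycle x (P.symm ⟨b, h⟩)) := by
        intro b hb
        induction hb with
        | refl =>
          refine ⟨((mA _).1 x.2).1, fun h => Equiv.Perm.SameCycle.refl _ _, fun h => ?_⟩
          have h1 := ((mA _).1 x.2).2
          have h2 := ((mC _).1 h).2
          rw [h1] at h2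
          cases h2
        | @tail u v hu huv ih =>
          obtain ⟨hun, ih1, ih2⟩ := ih
          rcases huv with ⟨-, rfl | rfl⟩
          · refine ⟨hπ.maps _ hun, fun h => ?_, fun h => ?_⟩
            · have hc : u ∈ C := (mC _).2 ⟨hun, by
                have := ((mA _).1 h).2
                rw [hXπ u hun] at this
                simpa using this⟩
              have := ih2 hc
              have he : P.symm ⟨u, hc⟩ = ⟨π u, h⟩ := Subtype.ext (hP' _)
              rwa [he] at this
            · have hc : u ∈ A := (mA _).2 ⟨hun, by
                have := ((mC _).1 h).2
                rw [hXπ u hun] at this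
                simpa using this⟩
              have := ih1 hc
              have he : P.symm ⟨π u, h⟩ = ⟨u, hc⟩ :=
                Subtype.ext ((hP' _).trans (hπ.invol u hun))
              rwa [he]
          · refine ⟨hρ.maps _ hun, fun h => ?_, fun h => ?_⟩
            · have hc : u ∈ C := (mC _).2 ⟨hun, by
                have := ((mA _).1 h).2
                rw [hXρ u hun] at this
                simpa using this⟩
              have := ih2 hc
              rw [← Equiv.Perm.sameCycle_apply_right]
              have he : P.symm ⟨u, hc⟩ = τ ⟨ρ u, h⟩ := Subtype.ext (by
                rw [hP', hτ]
                simp only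
                rw [hρ.invol u hun])
              rwa [he] at this
            · have hc : u ∈ A := (mA _).2 ⟨hun, by
                have := ((mC _).1 h).2
                rw [hXρ u hun] at this
                simpa using this⟩
              have := ih1 hc
              have he : P.symm ⟨ρ u, h⟩ = τ ⟨u, hc⟩ := Subtype.ext (by rw [hP', hτ])
              rw [he, Equiv.Perm.sameCycle_apply_right]
              exact this
      obtain ⟨-, h1, -⟩ := gen y h
      exact h1 y.2
    · intro h
      obtain ⟨k, rfl⟩ := h.exists_nat_pow_eq
      induction k with
      | zero => exact Relation.ReflTransGen.refl
      | succ k ih =>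
        have hk := ih ⟨k, by simp⟩
        have hmem := ((mA _).1 ((τ ^ k) x).2).1
        rw [pow_succ', Equiv.Perm.mul_apply, hτ]
        refine (Relation.ReflTransGen.tail hk ⟨hmem, Or.inr rfl⟩).tail
          ⟨hρ.maps _ hmem, Or.inl rfl⟩
  let F : ℕ → Finset ℕ := fun a => (nodes n).filter (fun b => compRel n π ρ a b)
  have hF : ∀ a ∈ nodes n, ∀ b ∈ nodes n, F a = F b ↔ compRel n π ρ a b := by
    intro a ha b hb
    constructor
    · intro h
      have : b ∈ F b := by
        simp only [F, Finset.mem_filter]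
        exact ⟨hb, Relation.ReflTransGen.refl⟩
      rw [← h] at this
      exact (Finset.mem_filter.1 this).2
    · intro h
      ext z
      simp only [F, Finset.mem_filter, and_congr_right_iff]
      intro _
      exact ⟨fun h' => (compRel_symm hπ hρ ha h).trans h', fun h' => h.trans h'⟩
  have hcomp : numComponents n π ρ
      = ((Finset.univ : Finset A).image (fun x : A => F x)).card := by
    have : numComponents n π ρ = ((nodes n).image F).card := by
      unfold numComponents
      congr!
    rw [this]
    congr 1
    ext z
    simp only [Finset.mem_image, Finset.mem_univ, true_and]
    constructor
    · rintro ⟨a, ha, rfl⟩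
      by_cases hXa : X a = true
      · exact ⟨⟨a, (mA _).2 ⟨ha, hXa⟩⟩, rfl⟩
      · have hm := hρ.maps a ha
        refine ⟨⟨ρ a, (mA _).2 ⟨hm, by rw [hXρ a ha]; simpa using hXa⟩⟩, ?_⟩
        refine (hF _ hm _ ha).2 ?_
        exact Relation.ReflTransGen.single ⟨hm, Or.inr (hρ.invol a ha).symm⟩
    · rintro ⟨a, rfl⟩
      exact ⟨a, ((mA _).1 a.2).1, rfl⟩
  have horb := card_orbits τ (fun x : A => F x) (fun x y => by
    rw [hF _ ((mA _).1 x.2).1 _ ((mA _).1 y.2).1, same])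
  rw [← hcomp, Fintype.card_coe, hAn] at horb
  have s4 := Equiv.Perm.sign_of_cycleType τ
  rw [s3] at s4
  have s5 : ((Equiv.Perm.sign σP : ℤˣ) : ℤ) * ((Equiv.Perm.sign σR : ℤˣ) : ℤ)
      = (-1) ^ (τ.cycleType.sum + Multiset.card τ.cycleType) := by
    rw [← Units.val_mul, s4]
    simp
  rw [← s1, ← s2, s5, ← pow_add]
  have hpar : Even (n + numComponents n π ρ)
      ↔ Even (τ.cycleType.sum + Multiset.card τ.cycleType) := by
    rw [Nat.even_iff, Nat.even_iff]
    omega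
  by_cases h : Even (n + numComponents n π ρ)
  · rw [h.neg_one_pow, (hpar.1 h).neg_one_pow]
  · rw [(Nat.not_even_iff_odd.1 h).neg_one_pow,
      (Nat.not_even_iff_odd.1 (fun h' => h (hpar.2 h'))).neg_one_pow]

lemma neg_one_pow_of_cast {a b : ℕ} (h : (a : ZMod 2) = b) : (-1 : ℤ) ^ a = (-1) ^ b := by
  rw [ZMod.natCast_eq_natCast_iff] at h
  rw [neg_one_pow_eq_pow_mod_two a, neg_one_pow_eq_pow_mod_two b, h]

lemma sum_nodes_cast (n : ℕ) : ∑ a ∈ nodes n, (a : ZMod 2) = n := by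
  unfold nodes
  induction n with
  | zero => simp
  | succ k ih =>
    rw [show 2 * (k + 1) = 2 * k + 1 + 1 by ring, Finset.sum_Icc_succ_top (by omega),
      Finset.sum_Icc_succ_top (by omega), ih]
    push_cast
    linear_combination (2 * (k : ZMod 2) + 1) * z2 1

lemma cast_eq_ind_odd (a : ℕ) : (a : ZMod 2) = ind (decide (a % 2 = 1) = true) := by
  rw [← ZMod.natCast_mod a 2]
  rcases Nat.mod_two_eq_zero_or_one a with h | h <;> simp [h, ind]

lemma invariant_iff {n : ℕ} {ρ : ℕ → ℕ} (hρ : IsPairing n ρ) {S : Finset ℕ}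
    (hS : Invariant S ρ) {i : ℕ} (hi : i ∈ nodes n) : ρ i ∈ S ↔ i ∈ S :=
  ⟨fun h => hρ.invol i hi ▸ hS _ h, fun h => hS _ h⟩

/-- Lemma 2.3.7: `sign(S)` formula. For a balanced `S` with `ρ₀` a
black-white pairing preserving `S` that is planar on `S` and on its complement,
`(−1)^{#crossings of ρ₀} = (−1)^n (−1)^{#components of π ∪ ρ} sign_OE(π) sign_BW(ρ)`
for any odd-even `π` preserving `S ∆ T` and black-white `ρ` preserving `S`. -/
theorem statement13 (n : ℕ) (c : ℕ → Bool) (hbal : BalancedColoring n c)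
    (S : Finset ℕ) (hS : S ⊆ nodes n) (hSbal : BalancedSubset c S)
    (ρ₀ : ℕ → ℕ) (hρ₀ : IsPairing n ρ₀) (hρ₀bw : IsBW n c ρ₀)
    (hρ₀inv : Invariant S ρ₀)
    (h₀S : numCrossingsOn S ρ₀ = 0) (h₀Sc : numCrossingsOn (nodes n \ S) ρ₀ = 0)
    (π : ℕ → ℕ) (hπ : IsPairing n π) (hπoe : IsOE n π)
    (hπinv : Invariant (symmDiff S (Tset n c)) π)
    (ρ : ℕ → ℕ) (hρ : IsPairing n ρ) (hρbw : IsBW n c ρ) (hρinv : Invariant S ρ) :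
    (-1 : ℤ) ^ (numCrossings n ρ₀)
      = (-1 : ℤ) ^ n * (-1 : ℤ) ^ (numComponents n π ρ)
          * signOE n π * signBW n c ρ := by

  let A : ℕ → Bool := fun i => c i == decide (i ∈ S)
  let O : ℕ → Bool := fun i => decide (i % 2 = 1)
  have hAρ : ∀ i ∈ nodes n, A (ρ i) = !(A i) := by
    intro i hi
    simp only [A, hρbw i hi, invariant_iff hρ hρinv hi]
    cases c i <;> cases decide (i ∈ S) <;> rfl
  have hOπ : ∀ i ∈ nodes n, O (π i) = !(O i) := by
    intro i hi
    have := hπoe i hi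
    simp only [O]
    by_cases h : i % 2 = 1
    · have h' : ¬ π i % 2 = 1 := by omega
      simp [h, h']
    · have h' : π i % 2 = 1 := by omega
      simp [h, h']
  have hAπ : ∀ i ∈ nodes n, A (π i) = !(A i) := by
    intro i hi
    have h1 := invariant_iff hπ hπinv hi
    have h2 := hπ.maps i hi
    have h3 := hπoe i hi
    have hp : (π i % 2 = 0 ∧ i % 2 = 1) ∨ (π i % 2 = 1 ∧ i % 2 = 0) := by omega
    simp only [Finset.mem_symmDiff, Tset, Finset.mem_filter, hi, h2, true_and] at h1
    simp only [A]
    by_cases s1 : i ∈ S <;> by_cases s2 : π i ∈ S <;> rcases hp with ⟨p1, p2⟩ | ⟨p1, p2⟩ <;>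
      cases c1 : c i <;> cases c2 : c (π i) <;> simp_all
  have hcomp := comps_formula hπ hρ A hAπ hAρ
  have hOE : signOE n π = (-1 : ℤ) ^ (invX n O π) := by
    unfold signOE invX
    simp [O]
  have hBW : signBW n c ρ = (-1 : ℤ) ^ (invX n c ρ) := rfl
  rw [hcomp, hOE, hBW]
  simp only [← pow_add]
  apply neg_one_pow_of_cast
  push_cast
  have k1 := inv_compare hπ A O hAπ hOπ
  have k2 := inv_compare hρ A c hAρ hρbw
  have k3 := cross_planar hρ₀ c hρ₀bw S hS hρ₀inv h₀S h₀Sc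
  have k1' : ∑ a ∈ nodes n, ((ind (A a = true) + ind (O a = true)) * ((a : ZMod 2) + 1)
        + ind (A a = true) * (1 + ind (O a = true))) = 0 := by
    refine Finset.sum_eq_zero fun a _ => ?_
    rw [cast_eq_ind_odd]
    change (ind (A a = true) + ind (O a = true)) * (ind (O a = true) + 1) + _ = _
    generalize ind (A a = true) = u
    generalize ind (O a = true) = v
    revert u v
    decide
  have k4 : ∑ a ∈ nodes n, ind (c a = true) = (n : ZMod 2) := by
    unfold ind
    rw [← Finset.sum_filter, Finset.sum_const, hbal]
    simp
  have k5 : ∑ a ∈ S, ((a : ZMod 2) + ind (c a = true))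
      = ∑ a ∈ nodes n, ind (a ∈ S) * ((a : ZMod 2) + ind (c a = true)) := by
    unfold ind
    simp only [ite_mul, one_mul, zero_mul]
    rw [← Finset.sum_filter]
    congr 1
    ext a
    simp only [Finset.mem_filter]
    exact ⟨fun h => ⟨hS h, h⟩, fun h => h.2⟩
  have k6 : ∑ a ∈ nodes n, ((ind (A a = true) + ind (c a = true)) * ((a : ZMod 2) + 1)
        + ind (A a = true) * (1 + ind (c a = true)))
      + ∑ a ∈ nodes n, ind (a ∈ S) * ((a : ZMod 2) + ind (c a = true))
      = ∑ a ∈ nodes n, (a : ZMod 2) + ∑ a ∈ nodes n, ind (c a = true) := by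
    simp only [← Finset.sum_add_distrib]
    refine Finset.sum_congr rfl fun a _ => ?_
    simp only [A]
    generalize (a : ZMod 2) = v
    by_cases h : a ∈ S <;> rcases Bool.eq_false_or_eq_true (c a) with hc | hc <;>
      simp [h, hc, ind] <;> revert v <;> decide
  rw [sum_nodes_cast, k4, z2] at k6
  rw [k3, k5, ← add_eq_zero_two k6, ← k2]
  rw [k1'] at k1
  linear_combination - k1

end DD
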